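/- arXiv:math/0102149 — 2 statements merged into one kernel-verified Lean document; each statement's English description precedes it below -/
import Mathlib

section
/- Let k be coprime to c and let x be an integer with k·x ≡ 1 (mod c). Then Λ(x/c) is the transpose of Λ(k/c); that is, Λ(r*) = Λ(r)ᵀ, where r = k/c and r* = x/c. -/
open Matrix Complex

abbrev SL2Z := Matrix.SpecialLinearGroup (Fin 2) ℤ

def sM : SL2Z := ⟨!![0, -1; 1, 0], by norm_num [Matrix.det_fin_two_of]⟩
def tM : SL2Z := ⟨!![1, 1; 0, 1], by norm_num [Matrix.det_fin_two_of]⟩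

/-- The reflection of `SL(2, ℤ)` in the antidiagonal, which exchanges the diagonal entries. -/
def antiTranspose (m : SL2Z) : SL2Z :=
  ⟨!![m.1 1 1, m.1 0 1; m.1 1 0, m.1 0 0], by
    have h := m.2
    rw [Matrix.det_fin_two] at h
    rw [Matrix.det_fin_two_of]
    linarith⟩

theorem antiTranspose_mul (a b : SL2Z) :
    antiTranspose (a * b) = antiTranspose b * antiTranspose a := by
  apply Subtype.ext
  change _ = (antiTranspose b).1 * (antiTranspose a).1
  ext i j
  fin_cases i <;> fin_cases j <;>
    simp [antiTranspose, Matrix.mul_apply, Fin.sum_univ_two] <;> ring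

theorem antiTranspose_one : antiTranspose 1 = 1 := by
  apply Subtype.ext
  ext i j
  fin_cases i <;> fin_cases j <;> simp [antiTranspose]

theorem antiTranspose_inv (a : SL2Z) : antiTranspose a⁻¹ = (antiTranspose a)⁻¹ := by
  apply eq_inv_of_mul_eq_one_left
  rw [← antiTranspose_mul, mul_inv_cancel, antiTranspose_one]

theorem antiTranspose_sM : antiTranspose sM = sM := by
  apply Subtype.ext
  ext i j
  fin_cases i <;> fin_cases j <;> rfl

theorem antiTranspose_tM : antiTranspose tM = tM := by
  apply Subtype.ext
  ext i j
  fin_cases i <;> fin_cases j <;> rfl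

theorem closure_sM_tM : Subgroup.closure {sM, tM} = (⊤ : Subgroup SL2Z) :=
  _root_.SpecialLinearGroup.SL2Z_generators

/-- A representation of `SL(2, ℤ)` in which both generators act by symmetric matrices
intertwines the antitranspose with the transpose. -/
theorem coe_map_antiTranspose {I : Type*} [Fintype I] [DecidableEq I]
    (ρ : SL2Z →* (Matrix I I ℂ)ˣ)
    (hs : (↑(ρ sM) : Matrix I I ℂ).IsSymm) (ht : (↑(ρ tM) : Matrix I I ℂ).IsSymm) (m : SL2Z) :
    (↑(ρ (antiTranspose m)) : Matrix I I ℂ) = (↑(ρ m) : Matrix I I ℂ)ᵀ := by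
  have hm : m ∈ Subgroup.closure {sM, tM} := closure_sM_tM ▸ Subgroup.mem_top m
  induction hm using Subgroup.closure_induction with
  | mem g hg =>
    rcases hg with rfl | rfl
    · rw [antiTranspose_sM, hs.eq]
    · rw [antiTranspose_tM, ht.eq]
  | one => simp [antiTranspose_one]
  | mul a b _ _ iha ihb =>
    rw [antiTranspose_mul, map_mul, map_mul, Units.val_mul, Units.val_mul, iha, ihb,
      Matrix.transpose_mul]
  | inv a _ iha =>
    rw [antiTranspose_inv, map_inv, map_inv, Matrix.coe_units_inv, Matrix.coe_units_inv, iha,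
      Matrix.transpose_nonsing_inv]

theorem stmt18
    {I : Type} [Fintype I] [DecidableEq I] [Nonempty I] (i0 : I)
    (ρ : SL2Z →* (Matrix I I ℂ)ˣ)
    (S T : Matrix I I ℂ)
    (hSdef : S = (↑(ρ sM) : Matrix I I ℂ)) (hTdef : T = (↑(ρ tM) : Matrix I I ℂ))
    (n N : ℕ) (hn : 0 < n) (hNpos : 0 < N) (hNdvd : N ∣ n)
    (hTdiag : T.IsDiag) (hTord : orderOf T = N)
    (hSsymm : S.IsSymm) (hSunit : Sᴴ * S = 1)
    (ζ : ℂ) (hζ : ζ = Complex.exp (2 * Real.pi * Complex.I / n))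
    (hSfield : ∀ p q, S p q ∈ IntermediateField.adjoin ℚ {ζ})
    (c : ℕ) (hc : 0 < c)
    (X : Matrix I I ℂ) (hXdiag : X.IsDiag) (hXpow : X ^ (c : ℕ) = T)
    (hXroot : ∀ p, X p p ^ n = 1)
    (Λ : ℤ → Matrix I I ℂ)
    (hΛ : ∀ (k x y : ℤ) (h : k * x - y * (c : ℤ) = 1),
      Λ k = X ^ (-k) *
        (↑(ρ ⟨!![k, y; (c : ℤ), x], by rw [Matrix.det_fin_two_of]; linarith⟩) : Matrix I I ℂ) *
        X ^ (-x))
    :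
    ∀ k x : ℤ, IsCoprime k (c : ℤ) → k * x ≡ 1 [ZMOD (c : ℤ)] → Λ x = (Λ k)ᵀ := by
  intro k x _ hkx
  obtain ⟨y, hy⟩ := hkx.symm.dvd
  have h : k * x - y * (c : ℤ) = 1 := by linarith
  have h' : x * k - y * (c : ℤ) = 1 := by linarith
  have hρ := coe_map_antiTranspose ρ (hSdef ▸ hSsymm) (hTdef ▸ hTdiag.isSymm)
    ⟨!![k, y; (c : ℤ), x], by rw [Matrix.det_fin_two_of]; linarith⟩
  rw [hΛ k x y h, hΛ x k y h', Matrix.transpose_mul, Matrix.transpose_mul, ← hρ,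
    Matrix.transpose_zpow, Matrix.transpose_zpow, hXdiag.isSymm.eq, mul_assoc]
  rfl
end

section
/- For every integer k coprime to c one has Λ(−k/c) = S²·conj(Λ(k/c)), where conj denotes entrywise complex conjugation. In particular, if S² is the permutation matrix of an involution p ↦ p̄ of I (charge conjugation, (S²)_{p,q} = δ_{p,q̄}), this reads Λ(−r)_p^q = conj(Λ(r)_{p̄}^q) for r = k/c. -/
open Matrix Complex

theorem coe_sM : (sM : Matrix (Fin 2) (Fin 2) ℤ) = !![0, -1; 1, 0] := rfl

theorem coe_tM : (tM : Matrix (Fin 2) (Fin 2) ℤ) = !![1, 1; 0, 1] := rfl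

/-- Conjugation of the matrix `g` in `SL(2, ℤ)` by `diag(1, -1)`. -/
def signConjFun (g : SL2Z) : SL2Z :=
  ⟨!![g 0 0, -g 0 1; -g 1 0, g 1 1], by
    have h := g.det_coe
    rw [Matrix.det_fin_two] at h
    rw [Matrix.det_fin_two_of]
    linarith⟩

theorem coe_signConjFun (g : SL2Z) :
    (signConjFun g : Matrix (Fin 2) (Fin 2) ℤ) = !![g 0 0, -g 0 1; -g 1 0, g 1 1] := rfl

/-- Conjugation by `diag(1, -1)` as an endomorphism of `SL(2, ℤ)`. -/
def signConj : SL2Z →* SL2Z where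
  toFun := signConjFun
  map_one' := by
    ext i j
    fin_cases i <;> fin_cases j <;> simp [coe_signConjFun]
  map_mul' g h := by
    ext i j
    fin_cases i <;> fin_cases j <;>
      simp [coe_signConjFun, Matrix.mul_apply, Fin.sum_univ_two] <;> ring

theorem coe_signConj (g : SL2Z) :
    (signConj g : Matrix (Fin 2) (Fin 2) ℤ) = !![g 0 0, -g 0 1; -g 1 0, g 1 1] := rfl

theorem signConj_sM : signConj sM = sM⁻¹ := by
  ext i j
  rw [Matrix.SpecialLinearGroup.coe_inv, coe_signConj, coe_sM, Matrix.adjugate_fin_two_of]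
  fin_cases i <;> fin_cases j <;> simp

theorem signConj_tM : signConj tM = tM⁻¹ := by
  ext i j
  rw [Matrix.SpecialLinearGroup.coe_inv, coe_signConj, coe_tM, Matrix.adjugate_fin_two_of]
  fin_cases i <;> fin_cases j <;> simp

theorem sM_sq : sM ^ 2 = -1 := by
  ext i j
  rw [Matrix.SpecialLinearGroup.coe_pow, coe_sM]
  fin_cases i <;> fin_cases j <;> simp [pow_two]

theorem neg_one_mul_signConj {g g' : SL2Z}
    (h : (g' : Matrix (Fin 2) (Fin 2) ℤ) = !![-g 0 0, g 0 1; g 1 0, -g 1 1]) :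
    -1 * signConj g = g' := by
  rw [neg_one_mul]
  ext i j
  rw [Matrix.SpecialLinearGroup.coe_neg, coe_signConj, h]
  fin_cases i <;> fin_cases j <;> simp

theorem SL2Z_hom_ext {G : Type*} [Group G] {f g : SL2Z →* G}
    (hs : f sM = g sM) (ht : f tM = g tM) : f = g := by
  refine MonoidHom.eq_of_eqOn_dense SpecialLinearGroup.SL2Z_generators ?_
  rintro x (rfl | rfl)
  · exact hs
  · exact ht

/-- Entrywise complex conjugation on invertible matrices. -/
noncomputable def conjUnits (I : Type*) [Fintype I] [DecidableEq I] :
    (Matrix I I ℂ)ˣ →* (Matrix I I ℂ)ˣ :=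
  Units.map ((starRingEnd ℂ).mapMatrix : Matrix I I ℂ →+* Matrix I I ℂ).toMonoidHom

theorem coe_conjUnits {I : Type*} [Fintype I] [DecidableEq I] (u : (Matrix I I ℂ)ˣ) :
    (↑(conjUnits I u) : Matrix I I ℂ) = (↑u : Matrix I I ℂ).map (starRingEnd ℂ) := rfl

theorem map_conj_mul_self_of_isDiag {I : Type*} [Fintype I] [DecidableEq I]
    {X : Matrix I I ℂ} (hX : X.IsDiag) {n : ℕ} (hn : 0 < n) (hroot : ∀ p, X p p ^ n = 1) :
    X.map (starRingEnd ℂ) * X = 1 := by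
  rw [← hX.diagonal_diag, Matrix.diagonal_map (map_zero _), Matrix.diagonal_mul_diagonal,
    ← Matrix.diagonal_one]
  congr 1
  funext p
  have h := Complex.norm_eq_one_of_pow_eq_one (hroot p) hn.ne'
  simp [Complex.conj_mul', h]

theorem conjUnits_eq_signConj {I : Type*} [Fintype I] [DecidableEq I]
    {ρ : SL2Z →* (Matrix I I ℂ)ˣ} (hs : conjUnits I (ρ sM) = (ρ sM)⁻¹)
    (ht : conjUnits I (ρ tM) = (ρ tM)⁻¹) (g : SL2Z) :
    conjUnits I (ρ g) = ρ (signConj g) := by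
  have h : (conjUnits I).comp ρ = ρ.comp signConj := by
    apply SL2Z_hom_ext
    · simpa [signConj_sM] using hs
    · simpa [signConj_tM] using ht
  exact DFunLike.congr_fun h g

theorem stmt19
    {I : Type} [Fintype I] [DecidableEq I] [Nonempty I] (i0 : I)
    (ρ : SL2Z →* (Matrix I I ℂ)ˣ)
    (S T : Matrix I I ℂ)
    (hSdef : S = (↑(ρ sM) : Matrix I I ℂ)) (hTdef : T = (↑(ρ tM) : Matrix I I ℂ))
    (n N : ℕ) (hn : 0 < n) (hNpos : 0 < N) (hNdvd : N ∣ n)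
    (hTdiag : T.IsDiag) (hTord : orderOf T = N)
    (hSsymm : S.IsSymm) (hSunit : Sᴴ * S = 1)
    (ζ : ℂ) (hζ : ζ = Complex.exp (2 * Real.pi * Complex.I / n))
    (hSfield : ∀ p q, S p q ∈ IntermediateField.adjoin ℚ {ζ})
    (c : ℕ) (hc : 0 < c)
    (X : Matrix I I ℂ) (hXdiag : X.IsDiag) (hXpow : X ^ (c : ℕ) = T)
    (hXroot : ∀ p, X p p ^ n = 1)
    (Λ : ℤ → Matrix I I ℂ)
    (hΛ : ∀ (k x y : ℤ) (h : k * x - y * (c : ℤ) = 1),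
      Λ k = X ^ (-k) *
        (↑(ρ ⟨!![k, y; (c : ℤ), x], by rw [Matrix.det_fin_two_of]; linarith⟩) : Matrix I I ℂ) *
        X ^ (-x))
    (hSX : S ^ 2 * X = X * S ^ 2) :
    (∀ k : ℤ, IsCoprime k (c : ℤ) → Λ (-k) = S ^ 2 * (Λ k).map (starRingEnd ℂ)) ∧
    (∀ bar : I → I, (∀ p q, (S ^ 2) p q = if p = bar q then 1 else 0) →
      ∀ k : ℤ, IsCoprime k (c : ℤ) → ∀ p q,
        Λ (-k) p q = (starRingEnd ℂ) ((Λ k) (bar p) q)) := by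
  subst hSdef
  have hXX := map_conj_mul_self_of_isDiag hXdiag hn hXroot
  obtain ⟨u, rfl⟩ : IsUnit X := .of_mul_eq_one_right _ hXX
  have hu : conjUnits I u = u⁻¹ := eq_inv_of_mul_eq_one_left (Units.ext hXX)
  have hs : conjUnits I (ρ sM) = (ρ sM)⁻¹ := by
    refine eq_inv_of_mul_eq_one_left (Units.ext ?_)
    rw [Units.val_mul, coe_conjUnits, Units.val_one, ← hSunit]
    congr 1
    rw [Matrix.conjTranspose, hSsymm.eq]
    rfl
  have hut : u ^ c = ρ tM := Units.ext (by rw [Units.val_pow_eq_pow_val, hXpow, hTdef])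
  have ht : conjUnits I (ρ tM) = (ρ tM)⁻¹ := by
    rw [← hut, map_pow, hu, inv_pow]
  have hcomm : Commute (ρ sM ^ 2) u := Units.ext (by simpa using hSX)
  have main : ∀ k : ℤ, IsCoprime k (c : ℤ) →
      Λ (-k) = (↑(ρ sM) : Matrix I I ℂ) ^ 2 * (Λ k).map (starRingEnd ℂ) := by
    rintro k ⟨x, b, hxb⟩
    have h₁ : k * x - (-b) * (c : ℤ) = 1 := by linarith
    have h₂ : (-k) * (-x) - (-b) * (c : ℤ) = 1 := by linarith
    rw [hΛ k x (-b) h₁, hΛ (-k) (-x) (-b) h₂]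
    generalize_proofs hdet' hdet
    obtain ⟨g, hg⟩ : ∃ g : SL2Z, g = ⟨!![k, -b; (c : ℤ), x], hdet⟩ := ⟨_, rfl⟩
    obtain ⟨g', hg'⟩ : ∃ g' : SL2Z, g' = ⟨!![-k, -b; (c : ℤ), -x], hdet'⟩ := ⟨_, rfl⟩
    have hgg' : -1 * signConj g = g' := neg_one_mul_signConj (by rw [hg, hg']; rfl)
    rw [← hg, ← hg']
    simp only [← Matrix.coe_units_zpow, ← Units.val_mul, ← coe_conjUnits,
      ← Units.val_pow_eq_pow_val]
    congr 1
    rw [map_mul, map_mul, map_zpow, map_zpow, hu, conjUnits_eq_signConj hs ht,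
      _root_.inv_zpow', _root_.inv_zpow', ← mul_assoc, ← mul_assoc, (hcomm.zpow_right _).eq,
      ← hgg', map_mul, ← sM_sq, map_pow]
    simp only [mul_assoc]
  refine ⟨main, fun bar hbar k hk p q => ?_⟩
  have hinv : ∀ q, bar (bar q) = q := by
    intro q
    have h4 : (↑(ρ sM) : Matrix I I ℂ) ^ 2 * (↑(ρ sM) : Matrix I I ℂ) ^ 2 = 1 := by
      rw [← Units.val_pow_eq_pow_val, ← map_pow, ← Units.val_mul, ← map_mul, sM_sq]
      simp
    have h := congrFun (congrFun h4 q) q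
    rw [Matrix.mul_apply] at h
    simp only [hbar, mul_ite, mul_one, mul_zero, Finset.sum_ite_eq', Finset.mem_univ, if_true,
      Matrix.one_apply_eq] at h
    by_contra hne
    rw [if_neg (Ne.symm hne)] at h
    exact zero_ne_one h
  have hiff : ∀ r, p = bar r ↔ bar p = r := fun r =>
    ⟨fun h => by rw [h, hinv], fun h => by rw [← h, hinv]⟩
  rw [main k hk, Matrix.mul_apply]
  simp [hbar, hiff]
end
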